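/- arXiv:2410.14063 — 2 statements merged into one kernel-verified Lean document; each statement's English description precedes it below -/
import Mathlib

section
/- Let d ≥ 3 and let G be a d-regular nut graph. Let t be a positive integer and let S be a set of 2t positive integers of which exactly t are odd and exactly t are even. If d < 4t, then there exists ℓ ∈ ℕ with ℓ > max S such that for every prime number p ≥ ℓ, the cartesian product G □ Circ(2p, S) is a (d + 4t)-regular nut graph. -/
open SimpleGraph Matrix Module

open Classical in
/-- The real adjacency matrix of a simple graph. -/
noncomputable def adjMatR {V : Type*} [Fintype V] (G : SimpleGraph V) : Matrix V V ℝ :=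
  Matrix.of fun u v => if G.Adj u v then (1 : ℝ) else 0

/-- A nut graph: the kernel of the real adjacency matrix is one-dimensional and every
nonzero kernel vector has all entries nonzero. -/
def IsNutGraph {V : Type*} [Fintype V] (G : SimpleGraph V) : Prop :=
  Module.finrank ℝ (LinearMap.ker (adjMatR G).mulVecLin) = 1 ∧
    ∀ x : V → ℝ, (adjMatR G).mulVec x = 0 → x ≠ 0 → ∀ v, x v ≠ 0

/-- A graph is `d`-regular if every vertex has exactly `d` neighbours. -/
def IsRegularOfDeg {V : Type*} (G : SimpleGraph V) (d : ℕ) : Prop :=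
  ∀ v, (G.neighborSet v).ncard = d

/-- The circulant graph `Circ(n, S)` on vertex set `ℤ_n`. -/
def Circ (n : ℕ) (S : Finset ℕ) : SimpleGraph (ZMod n) :=
  SimpleGraph.circulantGraph ((fun k : ℕ => (k : ZMod n)) '' (S : Set ℕ))

/-- The Cayley graph `Cay(Γ, C)` (for `C` inversion-closed with `1 ∉ C`). -/
def cayleyGraph {Γ : Type*} [Group Γ] (C : Set Γ) : SimpleGraph Γ :=
  SimpleGraph.fromRel (fun u v => v * u⁻¹ ∈ C)

/-- Additive version of the Cayley graph. -/
def addCayleyGraph {Γ : Type*} [AddGroup Γ] (C : Set Γ) : SimpleGraph Γ :=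
  SimpleGraph.fromRel (fun u v => v - u ∈ C)

/-- A graph is a Cayley graph if it is isomorphic to `Cay(Γ, C)` for some finite group `Γ`
and some inversion-closed connection set `C ⊆ Γ \ {1}`. -/
def IsCayleyGraph {V : Type u} (G : SimpleGraph V) : Prop :=
  ∃ (Γ : Type u) (_ : Group Γ) (_ : Fintype Γ) (C : Set Γ),
    (1 : Γ) ∉ C ∧ (∀ c ∈ C, c⁻¹ ∈ C) ∧ Nonempty (G ≃g cayleyGraph C)

open Polynomial

section General

lemma Matrix.map_det_apply_eq_zero {n R K U : Type*} [Fintype n] [DecidableEq n] [CommRing R]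
    [CommRing K] [AddCommGroup U] [Module K U] (φ : R →+* Module.End K U) (M : Matrix n n R)
    (f : n → U) (h : ∀ i, ∑ j, φ (M i j) (f j) = 0) (k : n) : φ M.det (f k) = 0 := by
  have h1 : ∑ i, φ (M.adjugate k i) (∑ j, φ (M i j) (f j)) = 0 := by simp [h]
  have h2 : ∑ i, φ (M.adjugate k i) (∑ j, φ (M i j) (f j))
      = ∑ j, φ ((M.adjugate * M) k j) (f j) := by
    simp_rw [Matrix.mul_apply, map_sum, map_mul, LinearMap.sum_apply, Module.End.mul_apply]
    exact Finset.sum_comm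
  rw [h2, Matrix.adjugate_mul] at h1
  simpa [Matrix.smul_apply, Matrix.one_apply, apply_ite, ite_apply] using h1

lemma Polynomial.isCoprime_prod_cyclotomic {p : ℕ} (hp : p.Prime) {Q : ℚ[X]} (hQ : Q.eval 1 ≠ 0)
    (hdeg : Q.natDegree + 1 < p) :
    IsCoprime Q (∏ k ∈ (Nat.divisors (2 * p)).erase 2, cyclotomic k ℚ) := by
  have hQ0 : Q ≠ 0 := by rintro rfl; simp at hQ
  refine IsCoprime.prod_right fun k hk => IsCoprime.symm ?_
  obtain ⟨hk2, hk⟩ := Finset.mem_erase.1 hk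
  have hkd : k ∣ 2 * p := Nat.dvd_of_mem_divisors hk
  have hkpos : 0 < k := Nat.pos_of_mem_divisors hk
  rw [(cyclotomic.irreducible_rat hkpos).coprime_iff_not_dvd]
  intro hdvd
  by_cases hpk : p ∣ k
  · have h1 := natDegree_le_of_dvd hdvd hQ0
    rw [natDegree_cyclotomic] at h1
    have h2 := Nat.le_of_dvd (Nat.totient_pos.2 hkpos) (Nat.totient_dvd_of_dvd hpk)
    rw [Nat.totient_prime hp] at h2
    omega
  · have h1 : k ∣ 2 := ((hp.coprime_iff_not_dvd.2 hpk).symm).dvd_of_dvd_mul_right hkd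
    have h2 : k = 1 := by
      have := Nat.le_of_dvd two_pos h1
      omega
    subst h2
    rw [cyclotomic_one, ← C_1, dvd_iff_isRoot] at hdvd
    exact hQ hdvd

/-- The shift operator on real functions on `ℤ_N`. -/
noncomputable def zmodShift (N : ℕ) : Module.End ℚ (ZMod N → ℝ) :=
  LinearMap.funLeft ℚ ℝ (· + 1)

lemma zmodShift_pow_apply (N k : ℕ) (f : ZMod N → ℝ) (j : ZMod N) :
    (zmodShift N ^ k) f j = f (j + k) := by
  induction k generalizing j with
  | zero => simp
  | succ k ih =>
    rw [pow_succ', Module.End.mul_apply]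
    change ((zmodShift N ^ k) f) (j + 1) = _
    rw [ih]
    congr 1
    push_cast
    ring

/-- If a polynomial of small degree not vanishing at `1` annihilates a function on `ℤ_{2p}`
(under the shift action), then the function is alternating. -/
lemma alternating_of_aeval_zmodShift_eq_zero {p : ℕ} (hp : p.Prime) {Q : ℚ[X]}
    (hQ : Q.eval 1 ≠ 0) (hdeg : Q.natDegree + 1 < p) {f : ZMod (2 * p) → ℝ}
    (hf : aeval (zmodShift (2 * p)) Q f = 0) (j : ZMod (2 * p)) : f (j + 1) = - f j := by
  obtain ⟨a, b, hab⟩ := isCoprime_prod_cyclotomic hp hQ hdeg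
  set R := ∏ k ∈ (Nat.divisors (2 * p)).erase 2, cyclotomic k ℚ
  have hpos : 0 < 2 * p := by have := hp.pos; omega
  have hR : R * (X + 1) = X ^ (2 * p) - 1 := by
    rw [← prod_cyclotomic_eq_X_pow_sub_one hpos, ← cyclotomic_two ℚ]
    exact Finset.prod_erase_mul _ _ (Nat.mem_divisors.2 ⟨dvd_mul_right _ _, hpos.ne'⟩)
  have hper : aeval (zmodShift (2 * p)) (X ^ (2 * p) - 1 : ℚ[X]) f = 0 := by
    ext i
    have h2 : ((2 * p : ℕ) : ZMod (2 * p)) = 0 := ZMod.natCast_self _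
    simp only [map_sub, map_pow, aeval_X, map_one, LinearMap.sub_apply, Module.End.one_apply,
      Pi.sub_apply, zmodShift_pow_apply, h2, add_zero, sub_self, Pi.zero_apply]
  have h : aeval (zmodShift (2 * p)) (X + 1 : ℚ[X]) f = 0 := by
    have : (X + 1 : ℚ[X]) = (X + 1) * a * Q + b * (X ^ (2 * p) - 1) := by
      rw [← hR]; linear_combination -(X + 1 : ℚ[X]) * hab
    rw [this, map_add, map_mul, map_mul _ b, LinearMap.add_apply, Module.End.mul_apply,
      Module.End.mul_apply, hf, hper, map_zero, map_zero, add_zero]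
  have hj := congrFun h j
  have h1 := zmodShift_pow_apply (2 * p) 1 f j
  simp only [map_add, aeval_X, map_one, LinearMap.add_apply, Module.End.one_apply,
    Pi.add_apply, Pi.zero_apply] at hj
  rw [pow_one, Nat.cast_one] at h1
  linarith

end General

section Graph

open Classical in
lemma adjMatR_mulVec {V : Type*} [Fintype V] (G : SimpleGraph V) (x : V → ℝ) (v : V) :
    (adjMatR G).mulVec x v = ∑ u, if G.Adj v u then x u else 0 := by
  simp [Matrix.mulVec, dotProduct, adjMatR]

lemma ncard_neighborSet_eq_mulVec {V : Type*} [Fintype V] (G : SimpleGraph V) (v : V) :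
    ((G.neighborSet v).ncard : ℝ) = (adjMatR G).mulVec (fun _ => 1) v := by
  classical
  rw [adjMatR_mulVec, Set.ncard_eq_toFinset_card']
  simp only [Finset.sum_boole]
  congr 2
  ext
  simp

lemma adjMatR_boxProd_mulVec {V W : Type*} [Fintype V] [Fintype W] (G : SimpleGraph V)
    (H : SimpleGraph W) (x : V × W → ℝ) (v : V) (j : W) :
    (adjMatR (G □ H)).mulVec x (v, j)
      = (adjMatR G).mulVec (fun u => x (u, j)) v + (adjMatR H).mulVec (fun k => x (v, k)) j := by
  classical
  have h : ∀ (u : V) (k : W), (if (G □ H).Adj (v, j) (u, k) then x (u, k) else 0)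
      = (if j = k then (if G.Adj v u then x (u, k) else 0) else 0)
        + (if v = u then (if H.Adj j k then x (u, k) else 0) else 0) := by
    intro u k
    by_cases h1 : j = k <;> by_cases h2 : v = u
    · subst h1 h2; simp
    · subst h1; simp [boxProd_adj, h2]
    · subst h2; simp [boxProd_adj, h1]
    · simp [boxProd_adj, h1, h2]
  simp only [adjMatR_mulVec, Fintype.sum_prod_type, h, Finset.sum_add_distrib]
  congr 1
  · simp
  · rw [Finset.sum_comm]; simp

lemma adjMatR_circ_mulVec {p : ℕ} [NeZero (2 * p)] (S : Finset ℕ) (hpos : ∀ s ∈ S, 0 < s)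
    (hlt : ∀ s ∈ S, s < p) (y : ZMod (2 * p) → ℝ) (j : ZMod (2 * p)) :
    (adjMatR (Circ (2 * p) S)).mulVec y j = ∑ s ∈ S, (y (j + s) + y (j - s)) := by
  classical
  have hinj : ∀ a < 2 * p, ∀ b < 2 * p, (a : ZMod (2 * p)) = b → a = b := by
    intro a ha b hb h
    rw [ZMod.natCast_eq_natCast_iff', Nat.mod_eq_of_lt ha, Nat.mod_eq_of_lt hb] at h
    exact h
  have hne : ∀ a ∈ S, ∀ b ∈ S, (a : ZMod (2 * p)) ≠ -b := by
    intro a ha b hb h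
    have := hpos a ha
    have := hlt a ha
    have := hlt b hb
    have h' : ((a + b : ℕ) : ZMod (2 * p)) = (0 : ℕ) := by push_cast; rw [h]; ring
    have := hinj _ (by omega) _ (by omega) h'
    omega
  have hset : Finset.univ.filter (fun k => (Circ (2 * p) S).Adj j k)
      = S.image (fun s : ℕ => j + s) ∪ S.image (fun s : ℕ => j - s) := by
    ext k
    simp only [Circ, circulantGraph_adj, Finset.mem_filter, Finset.mem_univ, true_and,
      Finset.mem_union, Finset.mem_image, Set.mem_image, Finset.mem_coe]
    constructor
    · rintro ⟨-, ⟨s, hs, h⟩ | ⟨s, hs, h⟩⟩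
      · exact Or.inr ⟨s, hs, by rw [h]; ring⟩
      · exact Or.inl ⟨s, hs, by rw [h]; ring⟩
    · have h0 : ∀ s ∈ S, (s : ZMod (2 * p)) ≠ 0 := by
        intro s hs h
        have := hpos s hs
        have := hlt s hs
        have := hinj s (by omega) 0 (by omega) (by simpa using h)
        omega
      rintro (⟨s, hs, rfl⟩ | ⟨s, hs, rfl⟩)
      · exact ⟨by simpa using h0 s hs, Or.inr ⟨s, hs, by ring⟩⟩
      · refine ⟨fun h => h0 s hs ?_, Or.inl ⟨s, hs, by ring⟩⟩
        linear_combination h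
  rw [adjMatR_mulVec, ← Finset.sum_filter, hset, Finset.sum_union, Finset.sum_image,
    Finset.sum_image, Finset.sum_add_distrib]
  · intro a ha b hb h
    have := hlt a ha
    have := hlt b hb
    exact hinj a (by omega) b (by omega) (sub_right_injective h)
  · intro a ha b hb h
    have := hlt a ha
    have := hlt b hb
    exact hinj a (by omega) b (by omega) (add_right_injective j h)
  · rw [Finset.disjoint_left]
    simp only [Finset.mem_image]
    rintro _ ⟨a, ha, rfl⟩ ⟨b, hb, h⟩
    apply hne a ha b hb
    linear_combination -h

end Graph

section Polynomial

open Classical in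
/-- The matrix `X ^ M • (A + ∑ s ∈ S, (X ^ s + X ^ (-s)) • 1)`, where `A` is the adjacency matrix
of `G`. -/
noncomputable def boxCircMatrix {V : Type*} (G : SimpleGraph V) (S : Finset ℕ) (M : ℕ) :
    Matrix V V ℚ[X] :=
  Matrix.of fun u v => (if G.Adj u v then X ^ M else 0)
    + if u = v then ∑ s ∈ S, (X ^ (M + s) + X ^ (M - s)) else 0

open Classical in
lemma eval_one_det_boxCircMatrix_ne_zero {V : Type*} [Fintype V] {G : SimpleGraph V} {d : ℕ}
    (hreg : IsRegularOfDeg G d) {S : Finset ℕ} (hS : d < 2 * S.card) (M : ℕ) :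
    (boxCircMatrix G S M).det.eval 1 ≠ 0 := by
  rw [← coe_evalRingHom, RingHom.map_det]
  apply det_ne_zero_of_sum_row_lt_diag
  intro k
  have hentry : ∀ j, (evalRingHom (1 : ℚ)).mapMatrix (boxCircMatrix G S M) k j
      = (if G.Adj k j then 1 else 0) + if k = j then (2 * S.card : ℚ) else 0 := by
    intro j
    simp only [boxCircMatrix, RingHom.mapMatrix_apply, Matrix.map_apply, Matrix.of_apply,
      coe_evalRingHom, eval_add]
    congr 1
    · split_ifs <;> simp
    · split_ifs <;> simp [eval_finsetSum, ← two_mul, mul_comm]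
  have hrow : (∑ j, if G.Adj k j then (1 : ℝ) else 0) = d := by
    rw [← hreg k, ncard_neighborSet_eq_mulVec, adjMatR_mulVec]
  have hsum : ∑ j ∈ Finset.univ.erase k,
      ‖(evalRingHom (1 : ℚ)).mapMatrix (boxCircMatrix G S M) k j‖ ≤ d := by
    rw [← hrow]
    refine le_trans (Finset.sum_le_sum (g := fun j => if G.Adj k j then (1 : ℝ) else 0) ?_)
      (Finset.sum_le_univ_sum_of_nonneg fun j => by split_ifs <;> norm_num)
    intro j hj
    rw [hentry, if_neg (Finset.ne_of_mem_erase hj).symm]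
    split_ifs <;> simp
  refine lt_of_le_of_lt hsum ?_
  rw [hentry]
  simp only [SimpleGraph.irrefl, if_false, if_true, zero_add]
  have h2 : ‖(2 * S.card : ℚ)‖ = 2 * S.card := by
    rw [← Rat.norm_cast_real]
    push_cast
    exact Real.norm_of_nonneg (by positivity)
  rw [h2]
  exact_mod_cast hS

open Classical in
lemma aeval_det_boxCircMatrix_eq_zero {V : Type*} [Fintype V] {G : SimpleGraph V} {p M : ℕ}
    [NeZero (2 * p)] {S : Finset ℕ} (hpos : ∀ s ∈ S, 0 < s) (hlt : ∀ s ∈ S, s < p)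
    (hM : ∀ s ∈ S, s ≤ M) {f : V × ZMod (2 * p) → ℝ}
    (hf : (adjMatR (G □ Circ (2 * p) S)).mulVec f = 0) (v : V) :
    aeval (zmodShift (2 * p)) (boxCircMatrix G S M).det (fun j => f (v, j)) = 0 := by
  refine Matrix.map_det_apply_eq_zero (aeval (zmodShift (2 * p))).toRingHom (boxCircMatrix G S M)
    (fun v j => f (v, j)) (fun i => ?_) v
  have hentry : ∀ (u : V) (j : ZMod (2 * p)),
      (aeval (zmodShift (2 * p)) (boxCircMatrix G S M i u)) (fun j => f (u, j)) j
      = (if G.Adj i u then f (u, j + M) else 0)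
        + if i = u then ∑ s ∈ S, (f (u, j + M + s) + f (u, j + M - s)) else 0 := by
    intro u j
    simp only [boxCircMatrix, Matrix.of_apply, map_add, LinearMap.add_apply, Pi.add_apply]
    congr 1
    · split_ifs
      · simp [zmodShift_pow_apply]
      · simp
    · split_ifs
      · simp only [map_sum, map_add, map_pow, aeval_X, LinearMap.sum_apply, LinearMap.add_apply,
          Finset.sum_apply, Pi.add_apply, zmodShift_pow_apply]
        refine Finset.sum_congr rfl fun s hs => ?_
        rw [Nat.cast_sub (hM s hs), Nat.cast_add, add_assoc, add_sub_assoc]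
      · simp
  ext j
  have hk := congrFun hf (i, j + M)
  rw [adjMatR_boxProd_mulVec, adjMatR_circ_mulVec S hpos hlt, adjMatR_mulVec] at hk
  rw [Finset.sum_apply]
  refine (Finset.sum_congr rfl fun u _ => hentry u j).trans ?_
  rw [Finset.sum_add_distrib, Finset.sum_ite_eq Finset.univ i, if_pos (Finset.mem_univ i)]
  exact hk

end Polynomial

section Alternating

/-- The alternating sign vector on `ℤ_N`. -/
noncomputable def altSign (N : ℕ) (j : ZMod N) : ℝ := (-1) ^ j.val

lemma altSign_natCast (p k : ℕ) : altSign (2 * p) (k : ZMod (2 * p)) = (-1) ^ k := by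
  rw [altSign, ZMod.val_natCast, neg_one_pow_eq_pow_mod_two, Nat.mod_mul_right_mod,
    ← neg_one_pow_eq_pow_mod_two]

lemma altSign_ne_zero (N : ℕ) (j : ZMod N) : altSign N j ≠ 0 := by
  simp [altSign]

lemma altSign_add {p : ℕ} [NeZero (2 * p)] (j : ZMod (2 * p)) (k : ℕ) :
    altSign (2 * p) (j + k) = (-1) ^ k * altSign (2 * p) j := by
  rw [← ZMod.natCast_zmod_val j, ← Nat.cast_add, altSign_natCast, altSign_natCast, pow_add,
    mul_comm]

lemma altSign_sub {p : ℕ} [NeZero (2 * p)] (j : ZMod (2 * p)) (k : ℕ) :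
    altSign (2 * p) (j - k) = (-1) ^ k * altSign (2 * p) j := by
  have h := altSign_add (j - (k : ZMod (2 * p))) k
  rw [sub_add_cancel] at h
  rw [h, ← mul_assoc, ← mul_pow]
  simp

lemma eq_altSign_mul_of_alternating {p : ℕ} [NeZero (2 * p)] {f : ZMod (2 * p) → ℝ}
    (h : ∀ j, f (j + 1) = - f j) (j : ZMod (2 * p)) : f j = altSign (2 * p) j * f 0 := by
  have hnat : ∀ k : ℕ, f (k : ZMod (2 * p)) = (-1) ^ k * f 0 := by
    intro k
    induction k with
    | zero => simp
    | succ k ih => rw [Nat.cast_succ, h, ih]; ring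
  rw [← ZMod.natCast_zmod_val j, altSign_natCast, hnat]

lemma sum_neg_one_pow_eq_zero {S : Finset ℕ} {t : ℕ}
    (hodd : (S.filter (fun s => Odd s)).card = t) (heven : (S.filter (fun s => Even s)).card = t) :
    ∑ s ∈ S, (-1 : ℝ) ^ s = 0 := by
  rw [← Finset.sum_filter_add_sum_filter_not S (fun s => Even s)]
  simp only [Nat.not_even_iff_odd]
  have h1 : ∑ s ∈ S with Even s, (-1 : ℝ) ^ s = ∑ s ∈ S with Even s, 1 :=
    Finset.sum_congr rfl fun s hs => (Finset.mem_filter.1 hs).2.neg_one_pow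
  have h2 : ∑ s ∈ S with Odd s, (-1 : ℝ) ^ s = ∑ s ∈ S with Odd s, -1 :=
    Finset.sum_congr rfl fun s hs => (Finset.mem_filter.1 hs).2.neg_one_pow
  rw [h1, h2]
  simp [hodd, heven]

lemma card_eq_two_mul {S : Finset ℕ} {t : ℕ} (hodd : (S.filter (fun s => Odd s)).card = t)
    (heven : (S.filter (fun s => Even s)).card = t) : S.card = 2 * t := by
  have h := Finset.card_filter_add_card_filter_not (s := S) (fun s => Even s)
  simp only [Nat.not_even_iff_odd] at h
  omega

lemma adjMatR_boxProd_circ_mulVec_altSign {V : Type*} [Fintype V] (G : SimpleGraph V) {p : ℕ}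
    [NeZero (2 * p)] {S : Finset ℕ} (hpos : ∀ s ∈ S, 0 < s) (hlt : ∀ s ∈ S, s < p)
    (hS : ∑ s ∈ S, (-1 : ℝ) ^ s = 0) (x : V → ℝ) (v : V) (j : ZMod (2 * p)) :
    (adjMatR (G □ Circ (2 * p) S)).mulVec (fun w => altSign (2 * p) w.2 * x w.1) (v, j)
      = altSign (2 * p) j * (adjMatR G).mulVec x v := by
  rw [adjMatR_boxProd_mulVec, adjMatR_circ_mulVec S hpos hlt]
  have h : ∑ s ∈ S, (altSign (2 * p) (j + s) * x v + altSign (2 * p) (j - s) * x v)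
      = (∑ s ∈ S, (-1 : ℝ) ^ s) * (2 * altSign (2 * p) j * x v) := by
    rw [Finset.sum_mul]
    refine Finset.sum_congr rfl fun s _ => ?_
    rw [altSign_add, altSign_sub]
    ring
  have h' : (fun u => altSign (2 * p) j * x u) = altSign (2 * p) j • x := rfl
  rw [h, hS, zero_mul, add_zero, h', Matrix.mulVec_smul]
  rfl

end Alternating

lemma isRegularOfDeg_boxProd_circ {V : Type*} [Fintype V] {G : SimpleGraph V} {d p : ℕ}
    (hreg : IsRegularOfDeg G d) [NeZero (2 * p)] {S : Finset ℕ} (hpos : ∀ s ∈ S, 0 < s)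
    (hlt : ∀ s ∈ S, s < p) : IsRegularOfDeg (G □ Circ (2 * p) S) (d + 2 * S.card) := by
  rintro ⟨v, j⟩
  have h := ncard_neighborSet_eq_mulVec (G □ Circ (2 * p) S) (v, j)
  rw [adjMatR_boxProd_mulVec, adjMatR_circ_mulVec S hpos hlt, ← ncard_neighborSet_eq_mulVec,
    hreg v] at h
  have h' : (((G □ Circ (2 * p) S).neighborSet (v, j)).ncard : ℝ) = (d + 2 * S.card : ℕ) := by
    rw [h, Finset.sum_const, nsmul_eq_mul]
    push_cast
    ring
  exact_mod_cast h'

/-- If every kernel vector of `G □ Circ(2p, S)` is alternating in the second coordinate, then the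
product inherits the nut property from `G`. -/
lemma isNutGraph_boxProd_circ {V : Type*} [Fintype V] {G : SimpleGraph V} {p : ℕ}
    (hnut : IsNutGraph G) [NeZero (2 * p)] {S : Finset ℕ} (hpos : ∀ s ∈ S, 0 < s)
    (hlt : ∀ s ∈ S, s < p) (hS : ∑ s ∈ S, (-1 : ℝ) ^ s = 0)
    (halt : ∀ f, (adjMatR (G □ Circ (2 * p) S)).mulVec f = 0 →
      ∀ v j, f (v, j + 1) = - f (v, j)) : IsNutGraph (G □ Circ (2 * p) S) := by
  have hrep : ∀ f, (adjMatR (G □ Circ (2 * p) S)).mulVec f = 0 →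
      f = (fun w => altSign (2 * p) w.2 * f (w.1, 0)) ∧
        (adjMatR G).mulVec (fun v => f (v, 0)) = 0 := by
    intro f hf
    have hfe : f = fun w => altSign (2 * p) w.2 * f (w.1, 0) := by
      ext ⟨v, j⟩
      exact eq_altSign_mul_of_alternating (f := fun j => f (v, j)) (halt f hf v) j
    refine ⟨hfe, ?_⟩
    ext v
    have h := congrFun hf (v, 0)
    rw [hfe, adjMatR_boxProd_circ_mulVec_altSign G hpos hlt hS (fun v => f (v, 0))] at h
    exact (mul_eq_zero.1 h).resolve_left (altSign_ne_zero _ _)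
  obtain ⟨hfin, hne⟩ := hnut
  constructor
  · rw [finrank_eq_one_iff'] at hfin ⊢
    obtain ⟨⟨x, hx⟩, hx0, hspan⟩ := hfin
    rw [LinearMap.mem_ker, Matrix.mulVecLin_apply] at hx
    have hx0' : x ≠ 0 := fun h => hx0 (Subtype.ext h)
    refine ⟨⟨fun w => altSign (2 * p) w.2 * x w.1, ?_⟩, ?_, ?_⟩
    · rw [LinearMap.mem_ker, Matrix.mulVecLin_apply]
      ext ⟨v, j⟩
      rw [adjMatR_boxProd_circ_mulVec_altSign G hpos hlt hS, hx]
      simp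
    · intro h
      apply hx0'
      ext v
      have := congrFun (congrArg Subtype.val h) (v, 0)
      exact (mul_eq_zero.1 this).resolve_left (altSign_ne_zero _ _)
    · rintro ⟨f, hf⟩
      rw [LinearMap.mem_ker, Matrix.mulVecLin_apply] at hf
      obtain ⟨hfe, hker⟩ := hrep f hf
      obtain ⟨c, hc⟩ := hspan ⟨fun v => f (v, 0), hker⟩
      refine ⟨c, Subtype.ext ?_⟩
      ext ⟨v, j⟩
      have hcv : c * x v = f (v, 0) := congrFun (congrArg Subtype.val hc) v
      change c * (altSign (2 * p) j * x v) = f (v, j)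
      rw [congrFun hfe (v, j)]
      change _ = altSign (2 * p) j * f (v, 0)
      rw [← hcv]
      ring
  · rintro f hf hf0 ⟨v, j⟩
    obtain ⟨hfe, hker⟩ := hrep f hf
    have h0 : (fun v => f (v, 0)) ≠ 0 := by
      intro h
      apply hf0
      ext w
      rw [congrFun hfe w, Pi.zero_apply, congrFun h w.1, Pi.zero_apply, mul_zero]
    rw [hfe]
    exact mul_ne_zero (altSign_ne_zero _ _) (hne _ hker h0 v)

/-- Lemma: if `G` is a `d`-regular nut graph with `3 ≤ d`, and `S` consists of `t` odd and
`t` even positive integers with `d < 4t`, then there is `ℓ > max S` such that for every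
prime `p ≥ ℓ`, the graph `G □ Circ(2p, S)` is a `(d + 4t)`-regular nut graph. -/
theorem main_lemma {V : Type*} [Fintype V] (d : ℕ) (hd : 3 ≤ d) (G : SimpleGraph V)
    (hreg : IsRegularOfDeg G d) (hnut : IsNutGraph G)
    (t : ℕ) (ht : 1 ≤ t) (S : Finset ℕ) (hpos : ∀ s ∈ S, 0 < s)
    (hodd : (S.filter (fun s => Odd s)).card = t)
    (heven : (S.filter (fun s => Even s)).card = t)
    (hdt : d < 4 * t) :
    ∃ ℓ : ℕ, S.sup id < ℓ ∧ ∀ p : ℕ, ∀ hp : p.Prime, ℓ ≤ p →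
      haveI : NeZero (2 * p) := ⟨Nat.mul_ne_zero two_ne_zero hp.ne_zero⟩
      IsRegularOfDeg (G □ Circ (2 * p) S) (d + 4 * t) ∧ IsNutGraph (G □ Circ (2 * p) S) := by
  classical
  have hcard := card_eq_two_mul hodd heven
  have hQ := eval_one_det_boxCircMatrix_ne_zero hreg (S := S) (by omega) (S.sup id)
  set Q := (boxCircMatrix G S (S.sup id)).det
  refine ⟨S.sup id + Q.natDegree + 2, by omega, fun p hp hle => ?_⟩
  have : NeZero (2 * p) := ⟨Nat.mul_ne_zero two_ne_zero hp.ne_zero⟩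
  have hM : ∀ s ∈ S, s ≤ S.sup id := fun s hs => Finset.le_sup (f := id) hs
  have hlt : ∀ s ∈ S, s < p := fun s hs => by have := hM s hs; omega
  constructor
  · have h := isRegularOfDeg_boxProd_circ hreg hpos hlt
    rwa [hcard, ← mul_assoc] at h
  · refine isNutGraph_boxProd_circ hnut hpos hlt (sum_neg_one_pow_eq_zero hodd heven)
      fun f hf v j => ?_
    refine alternating_of_aeval_zmodShift_eq_zero hp hQ (by omega) (f := fun j => f (v, j)) ?_ j
    convert aeval_det_boxCircMatrix_eq_zero hpos hlt hM hf v
end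

section
/- Let G be the graph on vertex set {0, 1, …, 9} with edge set {01, 13, 32, 20, 45, 46, 67, 75, 72, 25, 50, 04, 41, 16, 63, 37, 90, 91, 92, 93, 84, 85, 86, 87, 89}. Then the cartesian product G □ Circ(38, {1, 2, 3, 6, 7, 10}) is a 17-regular nut graph of order 380. -/
open SimpleGraph Matrix Module

/-- The edge list of the example graph. -/
def exampleEdges : List (ℕ × ℕ) :=
  [(0,1),(1,3),(3,2),(2,0),(4,5),(4,6),(6,7),(7,5),(7,2),(2,5),(5,0),(0,4),
   (4,1),(1,6),(6,3),(3,7),(9,0),(9,1),(9,2),(9,3),(8,4),(8,5),(8,6),(8,7),(8,9)]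

/-- The example graph `G` on `10` vertices. -/
def exampleGraph : SimpleGraph (Fin 10) :=
  SimpleGraph.fromRel (fun u v => ((u : ℕ), (v : ℕ)) ∈ exampleEdges)

open Polynomial in
/-- Matrices intertwined by `X` remain intertwined after applying an integer polynomial. -/
theorem aeval_mul_eq_mul_aeval {m n : Type*} [Fintype m] [DecidableEq m] [Fintype n]
    [DecidableEq n] {A : Matrix m m ℝ} {C : Matrix n n ℝ} {X : Matrix m n ℝ}
    (h : A * X = X * C) (p : ℤ[X]) : aeval A p * X = X * aeval C p := by
  have hpow (k : ℕ) : A ^ k * X = X * C ^ k := by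
    induction k with
    | zero => simp
    | succ k ih => rw [pow_succ, Matrix.mul_assoc, h, ← Matrix.mul_assoc, ih, Matrix.mul_assoc,
        ← pow_succ]
  induction p using Polynomial.induction_on' with
  | add p q hp hq => simp only [map_add, Matrix.add_mul, Matrix.mul_add, hp, hq]
  | monomial k a =>
    simp only [aeval_monomial, eq_intCast, ← zsmul_eq_mul, Matrix.smul_mul,
      Matrix.mul_smul, hpow]

open Polynomial in
/-- Evaluating an integer polynomial commutes with casting the entries of a matrix to `ℝ`. -/
theorem aeval_map_intCast {n : Type*} [Fintype n] [DecidableEq n] (M : Matrix n n ℤ) (p : ℤ[X]) :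
    aeval (M.map (Int.cast : ℤ → ℝ)) p = (aeval M p).map (Int.cast : ℤ → ℝ) :=
  aeval_algHom_apply ((Int.castRingHom ℝ).mapMatrix (m := n)).toIntAlgHom M p

/-- The integer adjacency matrix of the example graph. -/
def exampleMat : Matrix (Fin 10) (Fin 10) ℤ :=
  Matrix.of fun u v =>
    if ((u : ℕ), (v : ℕ)) ∈ exampleEdges ∨ ((v : ℕ), (u : ℕ)) ∈ exampleEdges then 1 else 0

/-- The square of `exampleMat`. -/
def exampleMatSq : Matrix (Fin 10) (Fin 10) ℤ :=
  !![5, 2, 2, 3, 2, 2, 2, 2, 3, 2;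
    2, 5, 3, 2, 2, 2, 2, 2, 3, 2;
    2, 3, 5, 2, 2, 2, 2, 2, 3, 2;
    3, 2, 2, 5, 2, 2, 2, 2, 3, 2;
    2, 2, 2, 2, 5, 2, 2, 3, 2, 3;
    2, 2, 2, 2, 2, 5, 3, 2, 2, 3;
    2, 2, 2, 2, 2, 3, 5, 2, 2, 3;
    2, 2, 2, 2, 3, 2, 2, 5, 2, 3;
    3, 3, 3, 3, 2, 2, 2, 2, 5, 0;
    2, 2, 2, 2, 3, 3, 3, 3, 0, 5]

/-- The cube of `exampleMat`. -/
def exampleMatCube : Matrix (Fin 10) (Fin 10) ℤ :=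
  !![10, 14, 14, 10, 14, 14, 12, 12, 10, 15;
    14, 10, 10, 14, 14, 12, 14, 12, 10, 15;
    14, 10, 10, 14, 12, 14, 12, 14, 10, 15;
    10, 14, 14, 10, 12, 12, 14, 14, 10, 15;
    14, 14, 12, 12, 10, 14, 14, 10, 15, 10;
    14, 12, 14, 12, 14, 10, 10, 14, 15, 10;
    12, 14, 12, 14, 14, 10, 10, 14, 15, 10;
    12, 12, 14, 14, 10, 14, 14, 10, 15, 10;
    10, 10, 10, 10, 15, 15, 15, 15, 8, 17;
    15, 15, 15, 15, 10, 10, 10, 10, 17, 8]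

/-- The indicator function of the connection set of the circulant graph. -/
def circVec (k : ZMod 38) : ℤ :=
  if k ∈ ([1, 2, 3, 6, 7, 10, 28, 31, 32, 35, 36, 37] : List (ZMod 38)) then 1 else 0

/-- The convolution square of `circVec`. -/
def circVecSq : ZMod 38 → ℤ :=
  ![12, 6, 3, 6, 9, 6, 3, 4, 6, 6, 2, 2, 3, 4, 1, 0, 2, 2, 1, 0, 1, 2, 2, 0, 1, 4, 3, 2, 2, 6,
    6, 4, 3, 6, 9, 6, 3, 6]

/-- The convolution cube of `circVec`. -/
def circVecCube : ZMod 38 → ℤ :=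
  ![48, 66, 81, 70, 45, 51, 73, 63, 37, 37, 57, 48, 30, 24, 36, 39, 24, 16, 25, 36, 25, 16, 24,
    39, 36, 24, 30, 48, 57, 37, 37, 63, 73, 51, 45, 70, 81, 66]

/-- The fourth convolution power of `circVec`. -/
def circVecFourth : ZMod 38 → ℤ :=
  ![820, 700, 583, 660, 769, 684, 540, 560, 657, 624, 467, 440, 531, 540, 403, 344, 436, 476,
    388, 312, 388, 476, 436, 344, 403, 540, 531, 440, 467, 624, 657, 560, 540, 684, 769, 660,
    583, 700]

/-- The first column of the minimal polynomial of `exampleMat` evaluated at `-circulant circVec`. -/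
def circVecPoly : ZMod 38 → ℤ :=
  ![-1025304, -1031325, -1037270, -1027836, -1013568, -1011243, -1013724, -1003061, -983572,
    -975120, -976312, -968197, -948471, -937417, -940324, -938491, -923663, -913603, -920204,
    -926934, -920204, -913603, -923663, -938491, -940324, -937417, -948471, -968197, -976312,
    -975120, -983572, -1003061, -1013724, -1011243, -1013568, -1027836, -1037270, -1031325]

/-- A multiplier turning `circVecPoly` into a multiple of `δ₀ + δ₁` under convolution. -/
def circMultiplier : ZMod 38 → ℤ :=
  ![0, 16030868071680270831807233923856031646831979,
    9898894887879181548567044022942976397414400, -25035298769956029009195072095448009846958741,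
    -30946666725432470572669876846717286179307520,
    27186787768492516953535074730615547107429739, -2369235310334573443887132629931004070799360,
    38971542034130124091676391791993000280268139, 29613875248141465283150910194947959045504000,
    -32521215080024201853719530916424508751816341,
    -46509519481431038520603173088978000006743040, 350812020476511534554416102734632451009899,
    -31284761991337635838182663160690841406182400,
    34651666918641126449714028488789892623876459, 37912542311323846966337179951435781912340480,
    -8373634774122930310411721235400232781604501,
    -21886873444680247602887123606302890288752640, 535607729485923085374414721129678884279659,
    -24336527734479989639060091546538110325432320,
    36126552032751330369931426031919999109892459, 20095683961071059538124192108063967463060480,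
    -8305659662799718807252857622682078678600341,
    -15495260342194347746432819202726352762552320,
    -5856005372999976771079889682446858641920661,
    -24404502845803201142218955159256264428436480,
    53943410383004117798144413875291813559172459, 18620798846960855617906794564933860977044480,
    -15253893919657365006375429236834809759350421,
    -15680056051203759297252817821121399195822080,
    -30478651409750767688795939165121968359911061,
    -48552083151704472685526764840280540398648320,
    45644743319821736114958144118803990692335979, 22940673962449853259869157868136968633436160,
    13661632761345697387920101293925027576032619, 11155919696812246121727840806759515460597760,
    -14915798653752199740862642922861254532475541,
    -41066166841636299841002306019304041493790720, 25929762959559452380374277946799008044246379]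

/-- The function `δ₀ + δ₁`. -/
def deltaPair (k : ZMod 38) : ℤ := if k = 0 ∨ k = 1 then 1 else 0

open Polynomial in
/-- The minimal polynomial of `exampleMat`. -/
noncomputable def exampleMinpoly : ℤ[X] :=
  X ^ 3 * (X ^ 2 * X ^ 2 - 2 * X ^ 3 - 19 * X ^ 2 + 6 * X + 74) - 4 * X ^ 2 - 80 * X

theorem exampleMat_sq : exampleMat ^ 2 = exampleMatSq := by
  rw [sq]; decide +kernel

theorem exampleMat_cube : exampleMat ^ 3 = exampleMatCube := by
  rw [pow_succ, exampleMat_sq]; decide +kernel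

open Polynomial in
theorem aeval_exampleMat : aeval exampleMat exampleMinpoly = 0 := by
  simp only [exampleMinpoly, map_sub, map_add, map_mul, map_pow, aeval_X, map_ofNat,
    exampleMat_sq, exampleMat_cube]
  decide +kernel

theorem circulant_circVec_sq : circulant circVec ^ 2 = circulant circVecSq := by
  rw [sq, circulant_mul]
  congr 1
  decide +kernel

theorem circulant_circVec_cube : circulant circVec ^ 3 = circulant circVecCube := by
  rw [pow_succ, circulant_circVec_sq, circulant_mul]
  congr 1
  decide +kernel

theorem circulant_circVec_fourth : circulant circVecSq * circulant circVecSq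
    = circulant circVecFourth := by
  rw [circulant_mul]
  congr 1
  decide +kernel

open Polynomial in
theorem aeval_neg_circulant :
    aeval (-circulant circVec) exampleMinpoly = circulant circVecPoly := by
  have h1 : -circulant circVecFourth + 2 * -circulant circVecCube + 19 * circulant circVecSq
      + 6 * circulant circVec - 74 = circulant (-circVecFourth - (2 : ℤ) • circVecCube
        + (19 : ℤ) • circVecSq + (6 : ℤ) • circVec - (74 : ℤ) • Pi.single 0 1) := by
    have h74 : (74 : Matrix (ZMod 38) (ZMod 38) ℤ) = (74 : ℤ) • 1 := by simp
    simp only [circulant_sub, circulant_add, circulant_neg, circulant_smul, circulant_single_one,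
      h74]
    noncomm_ring
  have h2 : circVecPoly = circulant circVecCube *ᵥ (-circVecFourth - (2 : ℤ) • circVecCube
        + (19 : ℤ) • circVecSq + (6 : ℤ) • circVec - (74 : ℤ) • Pi.single 0 1)
        - (4 : ℤ) • circVecSq + (80 : ℤ) • circVec := by
    decide +kernel
  rw [h2, circulant_add, circulant_sub, ← circulant_mul, ← h1, circulant_smul, circulant_smul]
  simp only [exampleMinpoly, map_sub, map_add, map_mul, map_pow, aeval_X, map_ofNat,
    ← circulant_circVec_fourth, ← circulant_circVec_cube, ← circulant_circVec_sq]
  noncomm_ring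

theorem circulant_poly_mul_multiplier : circulant circVecPoly * circulant circMultiplier
    = (679459946643329721192299152399157880633646080 : ℤ) • circulant deltaPair := by
  rw [circulant_mul, ← circulant_smul]
  congr 1
  decide +kernel

theorem exampleGraph_adj (u v : Fin 10) : exampleGraph.Adj u v ↔ exampleMat u v = 1 := by
  have key : ∀ p : Fin 10 × Fin 10, (p.1 ≠ p.2 ∧ (((p.1 : ℕ), (p.2 : ℕ)) ∈ exampleEdges ∨
      ((p.2 : ℕ), (p.1 : ℕ)) ∈ exampleEdges)) ↔ exampleMat p.1 p.2 = 1 := by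
    decide +kernel
  exact key (u, v)

theorem circ_adj (u v : ZMod 38) :
    (Circ 38 {1, 2, 3, 6, 7, 10}).Adj u v ↔ circulant circVec u v = 1 := by
  have key : ∀ k : ZMod 38, (k ≠ 0 ∧ (k ∈ ([1, 2, 3, 6, 7, 10] : List (ZMod 38)) ∨
      -k ∈ ([1, 2, 3, 6, 7, 10] : List (ZMod 38)))) ↔ circVec k = 1 := by
    decide +kernel
  rw [circulant_apply, ← key]
  simp [Circ, SimpleGraph.circulantGraph, SimpleGraph.fromRel_adj, sub_eq_zero,
    eq_comm (b := u - v), eq_comm (b := v - u)]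

theorem boxProd_adjMatR_mulVec (x : Fin 10 × ZMod 38 → ℝ) (i : Fin 10) (j : ZMod 38) :
    (adjMatR (exampleGraph □ Circ 38 {1, 2, 3, 6, 7, 10}) *ᵥ x) (i, j) =
      ∑ a, (exampleMat i a : ℝ) * x (a, j) + ∑ b, ((circulant circVec j b : ℤ) : ℝ) * x (i, b) := by
  have hA (a : Fin 10) : exampleMat i a = 0 ∨ exampleMat i a = 1 := by
    simp only [exampleMat, of_apply]; split_ifs <;> simp
  have hB (b : ZMod 38) : circulant circVec j b = 0 ∨ circulant circVec j b = 1 := by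
    simp only [circulant_apply, circVec]; split_ifs <;> simp
  have entry (a : Fin 10) (b : ZMod 38) :
      adjMatR (exampleGraph □ Circ 38 {1, 2, 3, 6, 7, 10}) (i, j) (a, b) =
        (if j = b then (exampleMat i a : ℝ) else 0) +
          (if i = a then ((circulant circVec j b : ℤ) : ℝ) else 0) := by
    have hloopA : exampleMat i i ≠ 1 := fun h => (exampleGraph_adj i i).not.mp (by simp) h
    have hloopB : circulant circVec j j ≠ 1 := fun h => (circ_adj j j).not.mp (by simp) h
    simp only [adjMatR, of_apply, boxProd_adj, exampleGraph_adj, circ_adj]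
    by_cases hj : j = b <;> by_cases hi : i = a
    · subst hj hi
      have h1 := (hA i).resolve_right hloopA
      have h2 := (hB j).resolve_right hloopB
      rw [h1, h2]
      simp
    · subst hj
      rcases hA a with h | h <;> simp [h, hi]
    · subst hi
      rcases hB b with h | h <;> rw [h] <;> simp [hj]
    · simp [hi, hj]
  simp only [mulVec, dotProduct, Fintype.sum_prod_type, entry, add_mul, Finset.sum_add_distrib,
    ite_mul, zero_mul, Finset.sum_ite_eq, Finset.mem_univ, if_true]
  congr 1
  rw [Finset.sum_comm]
  simp

/-- Every kernel vector of the product alternates in sign along the circulant factor. -/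
theorem apply_add_one_of_mem_ker {x : Fin 10 × ZMod 38 → ℝ}
    (hx : adjMatR (exampleGraph □ Circ 38 {1, 2, 3, 6, 7, 10}) *ᵥ x = 0) (i : Fin 10)
    (j : ZMod 38) : x (i, j + 1) = -x (i, j) := by
  set X : Matrix (Fin 10) (ZMod 38) ℝ := of fun i j => x (i, j) with hX
  have hsymm (a b : ZMod 38) : circulant circVec a b = circulant circVec b a := by
    have : ∀ k, circVec k = circVec (-k) := by decide +kernel
    rw [circulant_apply, circulant_apply, this, neg_sub]
  have hAX : exampleMat.map (Int.cast : ℤ → ℝ) * X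
      = X * (-circulant circVec).map (Int.cast : ℤ → ℝ) := by
    ext i j
    have h := boxProd_adjMatR_mulVec x i j
    rw [hx, Pi.zero_apply] at h
    simp only [mul_apply, map_apply, hX, of_apply, neg_apply, Int.cast_neg, mul_neg,
      Finset.sum_neg_distrib]
    rw [eq_neg_iff_add_eq_zero, h]
    congr 1
    exact Finset.sum_congr rfl fun b _ => by rw [hsymm, mul_comm]
  have h := aeval_mul_eq_mul_aeval hAX exampleMinpoly
  rw [aeval_map_intCast, aeval_map_intCast, aeval_exampleMat, aeval_neg_circulant,
    Matrix.map_zero _ Int.cast_zero, Matrix.zero_mul] at h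
  have h' := congrArg (· * (circulant circMultiplier).map (Int.cast : ℤ → ℝ)) h
  simp only [Matrix.zero_mul, Matrix.mul_assoc] at h'
  rw [← Matrix.map_mul_intCast, circulant_poly_mul_multiplier] at h'
  have hij := congrFun (congrFun h' i) j
  have hdelta (b : ZMod 38) : (deltaPair (b - j) : ℝ) =
      (if b = j then 1 else 0) + if b = j + 1 then 1 else 0 := by
    have : ∀ k : ZMod 38, deltaPair k = (if k = 0 then 1 else 0) + if k = 1 then 1 else 0 := by
      decide +kernel
    simp [this, sub_eq_iff_eq_add, add_comm 1 j]
  simp only [mul_apply, map_apply, Matrix.smul_apply, circulant_apply, smul_eq_mul, Int.cast_mul,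
    hdelta, mul_add, Finset.sum_add_distrib, mul_ite, mul_one, mul_zero, Finset.sum_ite_eq',
    Finset.mem_univ, if_true, hX, of_apply, Matrix.zero_apply] at hij
  push_cast at hij
  linarith

/-- A vector spanning the kernel of `exampleMat`. -/
def exampleKerVec (i : Fin 10) : ℤ := if i < 8 then -1 else 4

/-- The alternating function on `ZMod 38`. -/
def alternating (j : ZMod 38) : ℤ := (-1) ^ j.val

theorem eq_smul_exampleKerVec {y : Fin 10 → ℝ}
    (hy : ∀ i, ∑ a, (exampleMat i a : ℝ) * y a = 0) (i : Fin 10) :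
    y i = -y 0 * exampleKerVec i := by
  have h (i : Fin 10) := hy i
  simp only [Fin.forall_fin_succ, Fin.sum_univ_succ, exampleMat, exampleEdges, of_apply] at h
  simp at h
  obtain ⟨h0, h1, h2, h3, h4, h5, h6, h7, h8, h9⟩ := h
  fin_cases i <;> simp [exampleKerVec] <;> linarith

theorem eq_alternating {f : ZMod 38 → ℝ} (hf : ∀ j, f (j + 1) = -f j) (j : ZMod 38) :
    f j = f 0 * alternating j := by
  have h (n : ℕ) : f n = f 0 * (-1) ^ n := by
    induction n with
    | zero => simp
    | succ n ih => rw [Nat.cast_succ, hf, ih, pow_succ]; ring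
  have := h j.val
  rw [ZMod.natCast_zmod_val] at this
  rw [this, alternating]
  push_cast
  rfl

theorem sum_circulant_mul_alternating (j : ZMod 38) :
    ∑ b, circulant circVec j b * alternating b = 0 := by
  revert j
  decide +kernel

theorem sum_exampleMat_mul_kerVec (i : Fin 10) : ∑ a, exampleMat i a * exampleKerVec a = 0 := by
  revert i
  decide +kernel

/-- The kernel of the product is spanned by an explicit vector. -/
theorem mulVec_eq_zero_iff (x : Fin 10 × ZMod 38 → ℝ) :
    adjMatR (exampleGraph □ Circ 38 {1, 2, 3, 6, 7, 10}) *ᵥ x = 0 ↔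
      ∃ c : ℝ, x = c • fun p => (exampleKerVec p.1 * alternating p.2 : ℝ) := by
  have hsum (j : ZMod 38) : ∑ b, ((circulant circVec j b : ℤ) : ℝ) * alternating b = 0 := by
    exact_mod_cast sum_circulant_mul_alternating j
  constructor
  · intro hx
    have halt (i : Fin 10) (j : ZMod 38) : x (i, j) = x (i, 0) * alternating j :=
      eq_alternating (f := fun j => x (i, j)) (apply_add_one_of_mem_ker hx i) j
    have hker (i : Fin 10) : ∑ a, (exampleMat i a : ℝ) * x (a, 0) = 0 := by
      have h := boxProd_adjMatR_mulVec x i 0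
      have hB : ∑ b, ((circulant circVec 0 b : ℤ) : ℝ) * x (i, b) = 0 := by
        rw [← mul_zero (x (i, 0)), ← hsum 0, Finset.mul_sum]
        exact Finset.sum_congr rfl fun b _ => by rw [halt, mul_left_comm]
      rw [hx, hB, add_zero] at h
      exact h.symm
    refine ⟨-x (0, 0), funext fun ⟨i, j⟩ => ?_⟩
    rw [halt, eq_smul_exampleKerVec (y := fun a => x (a, 0)) hker i]
    simp only [Pi.smul_apply, smul_eq_mul]
    ring
  · rintro ⟨c, rfl⟩
    rw [mulVec_smul]
    convert smul_zero c
    ext ⟨i, j⟩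
    have hA : ∑ a, (exampleMat i a : ℝ) * exampleKerVec a = 0 := by
      exact_mod_cast sum_exampleMat_mul_kerVec i
    rw [boxProd_adjMatR_mulVec]
    simp_rw [← mul_assoc, ← Finset.sum_mul, hA, mul_right_comm _ (exampleKerVec i : ℝ),
      ← Finset.sum_mul, hsum]
    simp

theorem ncard_neighborSet_boxProd (v : Fin 10 × ZMod 38) :
    ((exampleGraph □ Circ 38 {1, 2, 3, 6, 7, 10}).neighborSet v).ncard = 17 := by
  classical
  rw [Set.ncard_eq_toFinset_card', ← neighborFinset_def, card_neighborFinset_eq_degree,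
    degree_boxProd]
  have h1 : ∀ u : Fin 10, (Finset.univ.filter fun w => exampleMat u w = 1).card = 5 := by
    decide +kernel
  have h2 : ∀ u : ZMod 38, (Finset.univ.filter fun w => circulant circVec u w = 1).card = 12 := by
    decide +kernel
  have h3 : exampleGraph.degree v.1 = 5 := by
    rw [← h1 v.1, ← card_neighborFinset_eq_degree, neighborFinset_eq_filter]
    simp only [exampleGraph_adj]
  have h4 : (Circ 38 {1, 2, 3, 6, 7, 10}).degree v.2 = 12 := by
    rw [← h2 v.2, ← card_neighborFinset_eq_degree, neighborFinset_eq_filter]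
    simp only [circ_adj]
  rw [h3, h4]

/-- `G □ Circ(38, {1, 2, 3, 6, 7, 10})` is a `17`-regular nut graph of order `380`. -/
theorem exampleBoxProd_is_nut :
    IsRegularOfDeg (exampleGraph □ Circ 38 {1, 2, 3, 6, 7, 10}) 17 ∧
    IsNutGraph (exampleGraph □ Circ 38 {1, 2, 3, 6, 7, 10}) ∧
    Fintype.card (Fin 10 × ZMod 38) = 380 := by
  have hne (p : Fin 10 × ZMod 38) : (exampleKerVec p.1 * alternating p.2 : ℝ) ≠ 0 := by
    refine mul_ne_zero (Int.cast_ne_zero.mpr ?_) (Int.cast_ne_zero.mpr ?_)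
    · rw [exampleKerVec]; split_ifs <;> norm_num
    · exact pow_ne_zero _ (by norm_num)
  refine ⟨ncard_neighborSet_boxProd, ⟨?_, ?_⟩, by simp [ZMod.card]⟩
  · rw [finrank_eq_one_iff']
    refine ⟨⟨fun p => (exampleKerVec p.1 * alternating p.2 : ℝ),
      (mulVec_eq_zero_iff _).mpr ⟨1, (one_smul _ _).symm⟩⟩, ?_, ?_⟩
    · intro h
      exact hne 0 (congrFun (congrArg Subtype.val h) 0)
    · rintro ⟨w, hw⟩
      obtain ⟨c, hc⟩ := (mulVec_eq_zero_iff w).mp hw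
      exact ⟨c, Subtype.ext hc.symm⟩
  · intro x hx hx0 v
    obtain ⟨c, rfl⟩ := (mulVec_eq_zero_iff x).mp hx
    exact mul_ne_zero (fun hc => hx0 (by rw [hc, zero_smul])) (hne v)
end
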